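/- arXiv:0711.4030 — 5 statements merged into one kernel-verified Lean document; each statement's English description precedes it below -/
import Mathlib

section
/- Let R be a (not necessarily commutative) ring and let x, y ∈ R satisfy y * x = - (x * y). Then for every natural number m, (x + y)^(2*m) = ∑_{k=0}^{m} (m choose k) * x^(2*k) * y^(2*(m-k)). -/
theorem add_sq_of_anticommute {R : Type*} [Ring R] {x y : R} (h : y * x = -(x * y)) :
    (x + y) ^ 2 = x ^ 2 + y ^ 2 := by
  rw [sq, add_mul, mul_add, mul_add, h, sq, sq]
  abel

theorem commute_sq_sq_of_anticommute {R : Type*} [Ring R] {x y : R} (h : y * x = -(x * y)) :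
    Commute (x ^ 2) (y ^ 2) := by
  have hy : Commute x (y ^ 2) := by
    rw [commute_iff_eq, sq, mul_assoc, h, mul_neg,
      ← mul_assoc y x y, h, neg_mul, neg_neg, mul_assoc]
  exact hy.pow_left 2

theorem pauli_pascal_even_row (R : Type*) [Ring R] (x y : R)
    (h : y * x = -(x * y)) (m : ℕ) :
    (x + y) ^ (2 * m) =
      ∑ k ∈ Finset.range (m + 1),
        (m.choose k : R) * x ^ (2 * k) * y ^ (2 * (m - k)) := by
  rw [pow_mul, add_sq_of_anticommute h, (commute_sq_sq_of_anticommute h).add_pow]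
  refine Finset.sum_congr rfl fun k _ => ?_
  rw [← Nat.cast_comm, pow_mul, pow_mul, mul_assoc]
end

section
/- Fix a natural number k ≥ 1 and define F^(k) : ℕ → ℕ by F^(k) 0 = 0, F^(k) 1 = 1, F^(k) (n+2) = F^(k) (n+1) + k * F^(k) n. Then for every natural number n, F^(k) (n+1) = ∑_{m=0}^{⌊n/2⌋} ((n-m) choose m) * k^m. -/
def fibOrder (k : ℕ) : ℕ → ℕ
  | 0 => 0
  | 1 => 1
  | n + 2 => fibOrder k (n + 1) + k * fibOrder k n

theorem fibOrder_succ_eq_sum_antidiagonal (k : ℕ) :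
    ∀ n : ℕ, fibOrder k (n + 1) =
      ∑ p ∈ Finset.HasAntidiagonal.antidiagonal n, p.1.choose p.2 * k ^ p.2 :=
  Nat.twoStepInduction (by simp [fibOrder]) (by simp [fibOrder, Finset.Nat.antidiagonal_succ])
    fun n h1 h2 => by
      rw [fibOrder, h1, h2, Finset.Nat.antidiagonal_succ_succ', Finset.Nat.antidiagonal_succ']
      simp only [Finset.sum_cons, Finset.sum_map, Finset.mul_sum, Function.Embedding.prodMap,
        Function.Embedding.coeFn_mk, Prod.map, Function.Embedding.refl_apply,
        Nat.succ_eq_add_one, Nat.choose_succ_succ, add_mul, Finset.sum_add_distrib, pow_succ]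
      simp [mul_comm, mul_assoc, add_comm, add_left_comm]

theorem fibOrder_diagonal_sum (k : ℕ) (hk : 1 ≤ k) (n : ℕ) :
    fibOrder k (n + 1) = ∑ m ∈ Finset.range (n / 2 + 1), (n - m).choose m * k ^ m := by
  rw [fibOrder_succ_eq_sum_antidiagonal, ← Finset.Nat.sum_antidiagonal_swap,
    Finset.Nat.sum_antidiagonal_eq_sum_range_succ_mk]
  symm
  apply Finset.sum_subset
  · intro m hm
    simp only [Finset.mem_range] at *
    omega
  · intro m hm hm'
    simp only [Finset.mem_range] at *
    rw [Nat.choose_eq_zero_of_lt (by omega), zero_mul]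
end

section
/- Work in ℂ. Let α, β ∈ ℂ satisfy α² = (1+√5)/2 and β² = (1-√5)/2. Define PF : ℕ → ℂ by PF n = (1/(2√5)) * (α^n + (-α)^n - β^n - (-β)^n + α^(n+3) + (-α)^(n+3) - β^(n+3) - (-β)^(n+3)). Then for every natural number m, PF (2m) = fib m and PF (2m+1) = fib (m+2). -/
theorem Complex.coe_fib_eq (n : ℕ) :
    (Nat.fib n : ℂ) =
      (((1 + Real.sqrt 5) / 2 : ℂ) ^ n - ((1 - Real.sqrt 5) / 2 : ℂ) ^ n) / Real.sqrt 5 := by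
  have h := congrArg (fun x : ℝ => (x : ℂ)) (Real.coe_fib_eq n)
  simpa [Real.goldenRatio, Real.goldenConj] using h

theorem pauliFib_split_binet (α β : ℂ)
    (hα : α ^ 2 = (1 + Real.sqrt 5) / 2) (hβ : β ^ 2 = (1 - Real.sqrt 5) / 2)
    (m : ℕ) :
    (fun n : ℕ =>
        (1 / (2 * (Real.sqrt 5 : ℂ))) *
          (α ^ n + (-α) ^ n - β ^ n - (-β) ^ n
            + α ^ (n + 3) + (-α) ^ (n + 3) - β ^ (n + 3) - (-β) ^ (n + 3)))
        (2 * m) = Nat.fib m ∧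
    (fun n : ℕ =>
        (1 / (2 * (Real.sqrt 5 : ℂ))) *
          (α ^ n + (-α) ^ n - β ^ n - (-β) ^ n
            + α ^ (n + 3) + (-α) ^ (n + 3) - β ^ (n + 3) - (-β) ^ (n + 3)))
        (2 * m + 1) = Nat.fib (m + 2) := by
  have even_pow (x : ℂ) (k : ℕ) : (-x) ^ (2 * k) = x ^ (2 * k) :=
    (even_two_mul k).neg_pow x
  have odd_pow (x : ℂ) (k : ℕ) : (-x) ^ (2 * k + 1) = -x ^ (2 * k + 1) :=
    (odd_two_mul_add_one k).neg_pow x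
  constructor
  · have h : 2 * m + 3 = 2 * (m + 1) + 1 := by ring
    simp only [h, even_pow, odd_pow]
    rw [Complex.coe_fib_eq, ← hα, ← hβ, ← pow_mul, ← pow_mul]
    ring
  · have h : 2 * m + 1 + 3 = 2 * (m + 2) := by ring
    simp only [h, even_pow, odd_pow]
    rw [Complex.coe_fib_eq, ← hα, ← hβ, ← pow_mul, ← pow_mul]
    ring
end

section
/- Work in ℂ. Define PJ : ℕ → ℂ by PJ n = (1/6) * ((1+√8) * (√2)^n + (1-√8) * (-√2)^n - (1-i) * i^n - (1+i) * (-i)^n), where √2 and √8 are the positive real square roots regarded as complex numbers and i is the imaginary unit. Let J : ℕ → ℕ be the Jacobsthal numbers, J 0 = 0, J 1 = 1, J (n+2) = J (n+1) + 2 * J n. Then for every natural number m, PJ (2m) = J m and PJ (2m+1) = J (m+2). -/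
def jacobsthal : ℕ → ℕ
  | 0 => 0
  | 1 => 1
  | n + 2 => jacobsthal (n + 1) + 2 * jacobsthal n

noncomputable def pauliJacobsthal (n : ℕ) : ℂ :=
  (1 / 6) *
    ((1 + (Real.sqrt 8 : ℂ)) * (Real.sqrt 2 : ℂ) ^ n
      + (1 - (Real.sqrt 8 : ℂ)) * (-(Real.sqrt 2 : ℂ)) ^ n
      - (1 - Complex.I) * Complex.I ^ n
      - (1 + Complex.I) * (-Complex.I) ^ n)

theorem three_mul_jacobsthal {R : Type*} [CommRing R] (n : ℕ) :
    3 * (jacobsthal n : R) = 2 ^ n - (-1) ^ n := by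
  induction n using Nat.twoStepInduction with
  | zero => simp [jacobsthal]
  | one => norm_num [jacobsthal]
  | more n ih₀ ih₁ =>
    simp only [jacobsthal]
    push_cast
    linear_combination ih₁ + 2 * ih₀

theorem Real.sqrt_eight : √8 = 2 * √2 := by
  rw [show (8 : ℝ) = 2 ^ 2 * 2 by norm_num, Real.sqrt_mul (by norm_num),
    Real.sqrt_sq (by norm_num)]

theorem pauliJacobsthal_interleave (m : ℕ) :
    pauliJacobsthal (2 * m) = jacobsthal m ∧
    pauliJacobsthal (2 * m + 1) = jacobsthal (m + 2) := by
  have hsq : (Real.sqrt 2 : ℂ) ^ 2 = 2 := by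
    exact_mod_cast Real.sq_sqrt (show (0 : ℝ) ≤ 2 by norm_num)
  have hI := Complex.I_sq
  constructor
  · have hJ := three_mul_jacobsthal (R := ℂ) m
    simp only [pauliJacobsthal, pow_mul, neg_sq, hsq, hI]
    linear_combination -(1 / 3) * hJ
  · have hJ := three_mul_jacobsthal (R := ℂ) (m + 2)
    simp only [pauliJacobsthal, Real.sqrt_eight, pow_succ _ (2 * m), pow_mul, neg_sq, hsq, hI]
    push_cast
    linear_combination -(1 / 3) * hJ + (2 / 3) * 2 ^ m * hsq + (1 / 3) * (-1) ^ m * hI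
end

section
/- Work in ℂ. Let α, β ∈ ℂ satisfy α² = (1+√13)/2 and β² = (1-√13)/2, and define PF3 : ℕ → ℂ by PF3 n = (1/(2√13)) * (α^n + (-α)^n - β^n - (-β)^n + α^(n+3) + (-α)^(n+3) - β^(n+3) - (-β)^(n+3)). Let F^(3) : ℕ → ℕ be defined by F^(3) 0 = 0, F^(3) 1 = 1, F^(3) (n+2) = F^(3) (n+1) + 3 * F^(3) n. Then for every natural number m, PF3 (2m) = F^(3) m and PF3 (2m+1) = F^(3) (m+2). -/
def fibThree : ℕ → ℕ
  | 0 => 0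
  | 1 => 1
  | n + 2 => fibThree (n + 1) + 3 * fibThree n

theorem sub_mul_fibThree {R : Type*} [CommRing R] {a b : R}
    (ha : a ^ 2 = a + 3) (hb : b ^ 2 = b + 3) (n : ℕ) :
    (a - b) * fibThree n = a ^ n - b ^ n := by
  induction n using fibThree.induct with
  | case1 => simp [fibThree]
  | case2 => simp [fibThree]
  | case3 n ih₁ ih₀ =>
    simp only [fibThree, Nat.succ_eq_add_one]
    push_cast
    linear_combination ih₁ + 3 * ih₀ - a ^ n * ha + b ^ n * hb

theorem pauliFibThree_interleave (α β : ℂ)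
    (hα : α ^ 2 = (1 + Real.sqrt 13) / 2) (hβ : β ^ 2 = (1 - Real.sqrt 13) / 2)
    (m : ℕ) :
    (fun n : ℕ =>
        (1 / (2 * (Real.sqrt 13 : ℂ))) *
          (α ^ n + (-α) ^ n - β ^ n - (-β) ^ n
            + α ^ (n + 3) + (-α) ^ (n + 3) - β ^ (n + 3) - (-β) ^ (n + 3)))
        (2 * m) = fibThree m ∧
    (fun n : ℕ =>
        (1 / (2 * (Real.sqrt 13 : ℂ))) *
          (α ^ n + (-α) ^ n - β ^ n - (-β) ^ n
            + α ^ (n + 3) + (-α) ^ (n + 3) - β ^ (n + 3) - (-β) ^ (n + 3)))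
        (2 * m + 1) = fibThree (m + 2) := by
  have hs : (Real.sqrt 13 : ℂ) ^ 2 = 13 := by
    rw [← Complex.ofReal_pow, Real.sq_sqrt (by norm_num)]
    norm_num
  have hs₀ : (Real.sqrt 13 : ℂ) ≠ 0 := by
    intro h
    norm_num [h] at hs
  have ha : (α ^ 2) ^ 2 = α ^ 2 + 3 := by
    rw [hα]
    linear_combination hs / 4
  have hb : (β ^ 2) ^ 2 = β ^ 2 + 3 := by
    rw [hβ]
    linear_combination hs / 4
  have binet (k : ℕ) : (Real.sqrt 13 : ℂ) * fibThree k = α ^ (2 * k) - β ^ (2 * k) := by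
    rw [pow_mul, pow_mul, ← sub_mul_fibThree ha hb, hα, hβ]
    ring
  have even_pow (k : ℕ) (x : ℂ) : (-x) ^ (2 * k) = x ^ (2 * k) := (even_two_mul k).neg_pow x
  have odd_pow (k : ℕ) (x : ℂ) : (-x) ^ (2 * k + 1) = -x ^ (2 * k + 1) :=
    (odd_two_mul_add_one k).neg_pow x
  constructor
  · simp only [show 2 * m + 3 = 2 * (m + 1) + 1 by ring, even_pow, odd_pow]
    field_simp
    linear_combination -2 * binet m
  · simp only [show 2 * m + 1 + 3 = 2 * (m + 2) by ring, even_pow, odd_pow]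
    field_simp
    linear_combination -2 * binet (m + 2)
end
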